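/- arXiv:1603.02699 — 4 statements merged into one kernel-verified Lean document; each statement's English description precedes it below -/
import Mathlib

section
/- For all integers m, n ≥ 1 there exists a constant c > 0 depending only on m and n such that: let e = (1/√n)(1,…,1) ∈ ℝ^n, let x_0 ∈ ℝ^n, r > 0, M ≥ 100mn, and set y_s = x_0 + sMr·e for s = 1,…,m; then for every i ∈ {1,…,n} and all j, l ∈ {1,…,m}, the partial-adjoint integral satisfies |∫_{B(y_1,r)×⋯×B(y_m,r)} K_j^{(i)}(z_l, z_1, …, z_{l−1}, x_0, z_{l+1}, …, z_m) dz_1⋯dz_m| ≥ c M^{−mn}, where in the kernel the point z_l occupies position 0 and the point x_0 occupies position l. -/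
open MeasureTheory Metric

/-- The `i`-th component of the `m`-linear Riesz kernel on `ℝⁿ`:
`K_j^{(i)}(y₀, …, y_m) = (y₀^{(i)} − y_j^{(i)})/|(y₀ − y₁, …, y₀ − y_m)|^{mn+1}`,
where the argument tuple is indexed by positions `0, 1, …, m` and `j ∈ {1, …, m}`
is encoded as `j : Fin m` acting on position `j.succ`. -/
noncomputable def rieszKernelComp (m n : ℕ) (j : Fin m) (i : Fin n)
    (y : Fin (m + 1) → EuclideanSpace ℝ (Fin n)) : ℝ :=
  (y 0 i - y j.succ i) / (Real.sqrt (∑ s : Fin m, ‖y 0 - y s.succ‖ ^ 2)) ^ (m * n + 1)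

/-- The unit vector `e = (1/√n)(1, …, 1) ∈ ℝⁿ`. -/
noncomputable def unitDiag (n : ℕ) : EuclideanSpace ℝ (Fin n) :=
  (EuclideanSpace.equiv (Fin n) ℝ).symm (fun _ => (Real.sqrt n)⁻¹)

theorem unitDiag_apply (n : ℕ) (i : Fin n) : unitDiag n i = (Real.sqrt n)⁻¹ := rfl

theorem norm_unitDiag {n : ℕ} (hn : 1 ≤ n) : ‖unitDiag n‖ = 1 := by
  have hn' : (0 : ℝ) < n := by exact_mod_cast hn
  rw [EuclideanSpace.norm_eq]
  simp [unitDiag_apply, hn'.ne']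

/-- A function of constant sign `σ` with `a ≤ σ f` on `S` has `a μ(S) ≤ |∫_S f|`. -/
theorem mul_measureReal_le_abs_setIntegral {α : Type*} [MeasurableSpace α] {μ : Measure α}
    {S : Set α} (hS : MeasurableSet S) (hμ : μ S ≠ ⊤) {f : α → ℝ} (hf : IntegrableOn f S μ)
    {a σ : ℝ} (hσ : |σ| = 1) (ha : ∀ z ∈ S, a ≤ σ * f z) :
    a * μ.real S ≤ |∫ z in S, f z ∂μ| := by
  have h := setIntegral_mono_on (integrableOn_const hμ) (hf.const_mul σ) hS ha
  rw [setIntegral_const, smul_eq_mul, mul_comm, integral_const_mul] at h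
  refine h.trans ((le_abs_self _).trans ?_)
  rw [abs_mul, hσ, one_mul]

theorem measureReal_pi_ball (m n : ℕ) (y : Fin m → EuclideanSpace ℝ (Fin n)) {r : ℝ} (hr : 0 < r) :
    (volume : Measure (Fin m → EuclideanSpace ℝ (Fin n))).real
        (Set.univ.pi fun s => ball (y s) r) =
      r ^ (m * n) * (volume : Measure (EuclideanSpace ℝ (Fin n))).real (ball 0 1) ^ m := by
  have h (s : Fin m) : (volume (ball (y s) r)).toReal =
      r ^ n * (volume : Measure (EuclideanSpace ℝ (Fin n))).real (ball 0 1) := by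
    rw [Measure.addHaar_ball_of_pos _ _ hr, finrank_euclideanSpace_fin, ENNReal.toReal_mul,
      ENNReal.toReal_ofReal (by positivity), Measure.real]
  rw [Measure.real, volume_pi_pi, ENNReal.toReal_prod]
  simp only [h, Finset.prod_const, Finset.card_univ, Fintype.card_fin]
  rw [mul_pow, ← pow_mul, mul_comm n m]

/-- The point at position `s + 1` of the kernel, once `x₀` has replaced `z_l`. -/
theorem update_cons_succ {m : ℕ} {E : Type*} (z : Fin m → E) (x₀ : E) (l s : Fin m) :
    Function.update (Fin.cons (z l) z : Fin (m + 1) → E) l.succ x₀ s.succ =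
      if s = l then x₀ else z s := by
  by_cases h : s = l
  · simp [h]
  · simp [h, Function.update_of_ne, Fin.succ_inj]

theorem update_cons_zero {m : ℕ} {E : Type*} (z : Fin m → E) (x₀ : E) (l : Fin m) :
    Function.update (Fin.cons (z l) z : Fin (m + 1) → E) l.succ x₀ 0 = z l := by
  rw [Function.update_of_ne (Fin.succ_ne_zero l).symm, Fin.cons_zero]

/-- The signed number of steps of length `Mr` from the centre at position `s + 1` of the kernel
to the centre at position `0`. -/
def centreGap {m : ℕ} (l s : Fin m) : ℤ :=
  if s = l then l + 1 else l - s

theorem centreGap_ne_zero {m : ℕ} (l s : Fin m) : centreGap l s ≠ 0 := by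
  unfold centreGap
  split_ifs with h
  · omega
  · have : (s : ℕ) ≠ l := fun h' => h (Fin.ext h')
    omega

theorem abs_centreGap_le {m : ℕ} (l s : Fin m) : |(centreGap l s : ℝ)| ≤ m := by
  have : |centreGap l s| ≤ m := by
    have := l.2
    have := s.2
    unfold centreGap
    rw [abs_le]
    split_ifs <;> omega
  exact_mod_cast this

/-- On the product of balls, each difference in the kernel is a multiple of `Mr e` up to `2r`. -/
theorem norm_sub_sub_centreGap_le {m : ℕ} {E : Type*} [NormedAddCommGroup E] [NormedSpace ℝ E]
    {x₀ v : E} {r : ℝ} (hr : 0 < r) {z : Fin m → E}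
    (hz : ∀ s : Fin m, z s ∈ closedBall (x₀ + ((s : ℕ) + 1 : ℝ) • v) r) (l s : Fin m) :
    ‖(z l - if s = l then x₀ else z s) - (centreGap l s : ℝ) • v‖ ≤ 2 * r := by
  have hl := hz l
  have hs := hz s
  rw [mem_closedBall, dist_eq_norm] at hl hs
  unfold centreGap
  split_ifs with h
  · push_cast
    rw [sub_sub]
    linarith
  · push_cast
    have : z l - z s - ((l : ℝ) - (s : ℝ)) • v =
        (z l - (x₀ + ((l : ℕ) + 1 : ℝ) • v)) - (z s - (x₀ + ((s : ℕ) + 1 : ℝ) • v)) := by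
      module
    rw [this]
    exact (norm_sub_le _ _).trans (by linarith)

theorem exists_abs_eq_one_and_one_le_mul {d : ℤ} (hd : d ≠ 0) :
    ∃ σ : ℝ, |σ| = 1 ∧ 1 ≤ σ * d := by
  rcases lt_or_gt_of_ne hd with h | h
  · refine ⟨-1, by simp, ?_⟩
    have : (d : ℝ) ≤ -1 := by exact_mod_cast (by omega : d ≤ -1)
    linarith
  · refine ⟨1, by simp, ?_⟩
    have : (1 : ℝ) ≤ d := by exact_mod_cast h
    linarith

theorem sqrt_sum_sq_le {m : ℕ} {a : Fin m → ℝ} {b : ℝ} (h0 : ∀ s, 0 ≤ a s) (hab : ∀ s, a s ≤ b) : Real.sqrt (∑ s, a s ^ 2) ≤ m * b := by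
  have h : √(∑ s, a s ^ 2) ≤ ∑ s, a s := by
    apply Real.sqrt_le_iff.2 ⟨Finset.sum_nonneg fun s _ => h0 s, ?_⟩
    exact Finset.sum_sq_le_sq_sum_of_nonneg fun s _ => h0 s
  refine h.trans ((Finset.sum_le_sum fun s _ => hab s).trans ?_)
  simp

/-- lower bound for the partial-adjoint integral of the multilinear Riesz
kernel: with `y_s = x₀ + sMr·e` (`s = 1, …, m`, `e = (1/√n)(1,…,1)`),
`|∫_{B(y₁,r)×⋯×B(y_m,r)} K_j^{(i)}(z_l, z₁, …, z_{l−1}, x₀, z_{l+1}, …, z_m) dz| ≥ c M^{−mn}`,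
where `z_l` occupies position `0` and `x₀` occupies position `l` in the kernel. -/
theorem rieszKernelComp_partial_adjoint_lower_bound (m n : ℕ) (hm : 1 ≤ m) (hn : 1 ≤ n) :
    ∃ c : ℝ, 0 < c ∧ ∀ (x₀ : EuclideanSpace ℝ (Fin n)) (r M : ℝ), 0 < r →
      (100 * m * n : ℝ) ≤ M →
      ∀ (i : Fin n) (j l : Fin m),
      c / M ^ (m * n) ≤
        |∫ z in Set.univ.pi (fun s : Fin m =>
              Metric.ball (x₀ + (((((s : ℕ) : ℝ) + 1)) * (M * r)) • unitDiag n) r),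
            rieszKernelComp m n j i (Function.update (Fin.cons (z l) z) l.succ x₀)| := by
  have hm1 : (1 : ℝ) ≤ m := by exact_mod_cast hm
  have hn1 : (1 : ℝ) ≤ n := by exact_mod_cast hn
  have hq : 1 ≤ √(n : ℝ) := Real.one_le_sqrt.2 hn1
  have hqn : √(n : ℝ) ≤ n := Real.sqrt_le_iff.2 ⟨by positivity, by nlinarith⟩
  set ω := (volume : Measure (EuclideanSpace ℝ (Fin n))).real (ball 0 1) with hω
  have hωpos : 0 < ω := ENNReal.toReal_pos (measure_ball_pos _ _ one_pos).ne' measure_ball_lt_top.ne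
  refine ⟨(2 * √(n : ℝ) * (2 * m ^ 2 : ℝ) ^ (m * n + 1))⁻¹ * ω ^ m, by positivity, ?_⟩
  intro x₀ r M hr hM i j l
  have hMn : 100 * √(n : ℝ) ≤ M := by nlinarith
  have hMpos : 0 < M := by linarith
  have hM100 : 100 ≤ M := by linarith
  obtain ⟨σ, hσ, hσd⟩ := exists_abs_eq_one_and_one_le_mul (centreGap_ne_zero l j)
  set v : EuclideanSpace ℝ (Fin n) := (M * r) • unitDiag n with hv
  have hvnorm : ‖v‖ = M * r := by
    rw [hv, norm_smul, norm_unitDiag hn, mul_one, Real.norm_of_nonneg (by positivity)]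
  have hvi : v i = M * r / √n := by
    simp [hv, unitDiag_apply, div_eq_mul_inv]
  simp only [mul_smul, ← hv, rieszKernelComp, update_cons_zero, update_cons_succ]
  set K : Set (Fin m → EuclideanSpace ℝ (Fin n)) :=
    Set.univ.pi fun s : Fin m => closedBall (x₀ + ((s : ℕ) + 1 : ℝ) • v) r with hK
  have hgap : ∀ z ∈ K, ∀ s, ‖(z l - if s = l then x₀ else z s) - (centreGap l s : ℝ) • v‖ ≤ 2 * r :=
    fun z hz s => norm_sub_sub_centreGap_le hr (fun s : Fin m => hz s (Set.mem_univ s)) l s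
  have hle : ∀ z ∈ K, ∀ s, ‖z l - if s = l then x₀ else z s‖ ≤ 2 * m * (M * r) := by
    intro z hz s
    have h1 : ‖(centreGap l s : ℝ) • v‖ ≤ m * (M * r) := by
      rw [norm_smul, hvnorm]
      exact mul_le_mul_of_nonneg_right (abs_centreGap_le l s) (by positivity)
    have h2 := norm_sub_norm_le (z l - if s = l then x₀ else z s) ((centreGap l s : ℝ) • v)
    have h3 : 2 * r ≤ m * (M * r) := by
      have : 2 ≤ m * M := by nlinarith
      nlinarith
    linarith [hgap z hz s]
  have hnum : ∀ z ∈ K, M * r / (2 * √n) ≤ σ * (z l i - (if j = l then x₀ else z j) i) := by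
    intro z hz
    have h := (PiLp.norm_apply_le _ i).trans (hgap z hz j)
    simp only [PiLp.sub_apply, PiLp.smul_apply, smul_eq_mul, hvi, Real.norm_eq_abs] at h
    have h1 : |σ * ((z l i - (if j = l then x₀ else z j) i) - centreGap l j * (M * r / √n))|
        ≤ 2 * r := by rwa [abs_mul, hσ, one_mul]
    have h2 := (abs_le.1 h1).1
    have h3 : 4 * r ≤ M * r / √n := by
      rw [le_div_iff₀ (by positivity)]
      nlinarith
    have h4 : M * r / √n ≤ σ * centreGap l j * (M * r / √n) :=
      le_mul_of_one_le_left (by positivity) hσd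
    have h5 : M * r / (2 * √n) = M * r / √n / 2 := by field_simp
    rw [h5]
    linarith
  have hpos : ∀ z ∈ K, 0 < √(∑ s, ‖z l - if s = l then x₀ else z s‖ ^ 2) := by
    intro z hz
    have h1 : z l i - (if j = l then x₀ else z j) i ≠ 0 := by
      intro h0
      have := hnum z hz
      rw [h0, mul_zero] at this
      have : 0 < M * r / (2 * √n) := by positivity
      linarith
    refine Real.sqrt_pos.2 (Finset.sum_pos' (fun s _ => by positivity) ⟨j, Finset.mem_univ j, ?_⟩)
    refine pow_pos (norm_pos_iff.2 fun h => h1 ?_) 2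
    simpa using congrArg (fun u : EuclideanSpace ℝ (Fin n) => u i) h
  have hBK : (Set.univ.pi fun s : Fin m => ball (x₀ + ((s : ℕ) + 1 : ℝ) • v) r) ⊆ K :=
    Set.pi_mono fun s _ => ball_subset_closedBall
  have hKc : IsCompact K := isCompact_univ_pi fun s => isCompact_closedBall _ _
  have hcont (s : Fin m) : Continuous fun z : Fin m → EuclideanSpace ℝ (Fin n) =>
      if s = l then x₀ else z s := by
    split_ifs <;> fun_prop
  have hint : IntegrableOn (fun z : Fin m → EuclideanSpace ℝ (Fin n) =>
      (z l i - (if j = l then x₀ else z j) i) /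
        √(∑ s, ‖z l - if s = l then x₀ else z s‖ ^ 2) ^ (m * n + 1)) K := by
    refine ContinuousOn.integrableOn_compact hKc (ContinuousOn.div ?_ ?_ ?_)
    · have := hcont j
      fun_prop
    · fun_prop
    · exact fun z hz => (pow_pos (hpos z hz) _).ne'
  have hmain := mul_measureReal_le_abs_setIntegral (σ := σ)
    (a := M * r / (2 * √n) / (m * (2 * m * (M * r))) ^ (m * n + 1))
    (MeasurableSet.univ_pi fun s => measurableSet_ball)
    ((measure_mono hBK).trans_lt hKc.measure_lt_top).ne (hint.mono_set hBK) hσ ?_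
  · refine le_trans (le_of_eq ?_) hmain
    rw [measureReal_pi_ball m n _ hr, ← hω]
    field_simp
    ring
  · intro z hz
    have hz := hBK hz
    rw [← mul_div_assoc]
    have h0 : 0 < M * r / (2 * √n) := by positivity
    refine div_le_div₀ (h0.le.trans (hnum z hz)) (hnum z hz) (pow_pos (hpos z hz) _) ?_
    exact pow_le_pow_left₀ (Real.sqrt_nonneg _)
      (sqrt_sum_sq_le (fun s => norm_nonneg _) (hle z hz)) _
end

section
/- Let m, n ≥ 1 be integers, l ∈ {1,…,m}, ε ∈ (0,1], A > 0, and let K : (ℝ^n)^{m+1} → ℝ be a measurable kernel satisfying the Calderón–Zygmund regularity condition of order ε with constant A in the variable of position l. Then there exists C > 0 depending only on m and n such that for every r > 0, every M ≥ 10, all points x_0, y_1, …, y_m ∈ ℝ^n with |x_0 − y_s| ≥ Mr for every s ∈ {1,…,m}, and every x ∈ B(x_0, r), one has ∫_{B(y_1,r)×⋯×B(y_m,r)} |K(z_l, z_1, …, z_{l−1}, x_0, z_{l+1}, …, z_m) − K(z_l, z_1, …, z_{l−1}, x, z_{l+1}, …, z_m)| dz_1⋯dz_m ≤ C A M^{−(mn+ε)},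 where in the kernel the point z_l occupies position 0 and the points x_0 and x occupy position l. -/
open MeasureTheory Metric

/-- `Σ_{0 ≤ k < k' ≤ m} |y_k − y_{k'}|`. -/
noncomputable def pairSum {m n : ℕ} (y : Fin (m + 1) → EuclideanSpace ℝ (Fin n)) : ℝ :=
  ∑ k : Fin (m + 1), ∑ k' : Fin (m + 1), if k < k' then ‖y k - y k'‖ else 0

lemma norm_sub_le_pairSum {m n : ℕ} (y : Fin (m + 1) → EuclideanSpace ℝ (Fin n))
    {i j : Fin (m + 1)} (hij : i < j) : ‖y i - y j‖ ≤ pairSum y := by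
  have hnonneg : ∀ k k' : Fin (m + 1), 0 ≤ if k < k' then ‖y k - y k'‖ else 0 := by
    intro k k'
    split_ifs <;> positivity
  calc ‖y i - y j‖ = if i < j then ‖y i - y j‖ else 0 := by rw [if_pos hij]
    _ ≤ ∑ k', if i < k' then ‖y i - y k'‖ else 0 :=
        Finset.single_le_sum (f := fun k' => if i < k' then ‖y i - y k'‖ else 0)
          (fun k' _ => hnonneg i k') (Finset.mem_univ j)
    _ ≤ pairSum y :=
        Finset.single_le_sum (f := fun k => ∑ k', if k < k' then ‖y k - y k'‖ else 0)
          (fun k _ => Finset.sum_nonneg fun k' _ => hnonneg k k') (Finset.mem_univ i)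

lemma volume_univ_pi_ball {m n : ℕ} (y : Fin m → EuclideanSpace ℝ (Fin n)) {r : ℝ} (hr : 0 < r) :
    volume (Set.univ.pi fun s => ball (y s) r) =
      (ENNReal.ofReal (r ^ n) * volume (ball (0 : EuclideanSpace ℝ (Fin n)) 1)) ^ m := by
  rw [volume_pi_pi]
  simp [Measure.addHaar_ball_of_pos volume _ hr]

lemma rpow_div_half_mul_rpow_le {r M ε d : ℝ} (hr : 0 < r) (hM : 0 < M) (hε : ε ≤ 1) :
    r ^ ε / (M * r / 2) ^ (d + ε) * r ^ d ≤ 2 ^ (d + 1) / M ^ (d + ε) := by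
  have hle : (2 : ℝ) ^ (d + ε) ≤ 2 ^ (d + 1) :=
    Real.rpow_le_rpow_of_exponent_le one_le_two (by linarith)
  have hrpow : r ^ (d + ε) = r ^ d * r ^ ε := Real.rpow_add hr d ε
  have hpos : 0 < r ^ (d + ε) := Real.rpow_pos_of_pos hr _
  calc r ^ ε / (M * r / 2) ^ (d + ε) * r ^ d
      = 2 ^ (d + ε) / M ^ (d + ε) := by
        rw [Real.div_rpow (by positivity) two_pos.le, Real.mul_rpow hM.le hr.le]
        have hMpos := Real.rpow_pos_of_pos hM (d + ε)
        field_simp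
        rw [hrpow, mul_comm]
    _ ≤ _ := by gcongr

/-- if `K` satisfies the Calderón–Zygmund regularity condition of order
`ε ∈ (0,1]` with constant `A` in the variable of position `l ∈ {1, …, m}` (encoded as
`l : Fin m`, position `l.succ`), then for `|x₀ − y_s| ≥ Mr` and `x ∈ B(x₀, r)`,
`∫_{B(y₁,r)×⋯×B(y_m,r)} |K(z_l, z₁, …, x₀, …, z_m) − K(z_l, z₁, …, x, …, z_m)| dz
  ≤ C A M^{−(mn+ε)}`, with `z_l` in position `0` and `x₀`, `x` in position `l`. -/
theorem kernel_regularity_integral_estimate (m n : ℕ) (hm : 1 ≤ m) (hn : 1 ≤ n) :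
    ∃ C : ℝ, 0 < C ∧ ∀ (l : Fin m) (ε A : ℝ), 0 < ε → ε ≤ 1 → 0 < A →
      ∀ K : (Fin (m + 1) → EuclideanSpace ℝ (Fin n)) → ℝ, Measurable K →
      (∀ (y : Fin (m + 1) → EuclideanSpace ℝ (Fin n)) (y' : EuclideanSpace ℝ (Fin n)),
        0 < ‖y l.succ - y'‖ →
        ‖y l.succ - y'‖ ≤
          (1 / 2) * Finset.univ.sup' Finset.univ_nonempty (fun k => ‖y l.succ - y k‖) →
        |K y - K (Function.update y l.succ y')| ≤
          A * ‖y l.succ - y'‖ ^ ε / pairSum y ^ ((m * n : ℝ) + ε)) →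
      ∀ r M : ℝ, 0 < r → 10 ≤ M →
      ∀ (x₀ : EuclideanSpace ℝ (Fin n)) (y : Fin m → EuclideanSpace ℝ (Fin n)),
      (∀ s, M * r ≤ ‖x₀ - y s‖) →
      ∀ x ∈ Metric.ball x₀ r,
      IntegrableOn (fun z : Fin m → EuclideanSpace ℝ (Fin n) =>
          |K (Function.update (Fin.cons (z l) z) l.succ x₀) -
            K (Function.update (Fin.cons (z l) z) l.succ x)|)
        (Set.univ.pi fun s => Metric.ball (y s) r) volume ∧
      (∫ z in Set.univ.pi (fun s => Metric.ball (y s) r),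
          |K (Function.update (Fin.cons (z l) z) l.succ x₀) -
            K (Function.update (Fin.cons (z l) z) l.succ x)|) ≤
        C * A / M ^ ((m * n : ℝ) + ε) := by
  set V : ℝ := volume.real (ball (0 : EuclideanSpace ℝ (Fin n)) 1) with hV
  have hVpos : 0 < V :=
    ENNReal.toReal_pos (measure_ball_pos volume _ one_pos).ne' measure_ball_lt_top.ne
  refine ⟨2 ^ ((m * n : ℝ) + 1) * V ^ m, by positivity, ?_⟩
  intro l ε A hε hε1 hA K hK hreg r M hr hM x₀ y hy x hx
  have hMr_pos : 0 < M * r := by positivity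
  set S : Set (Fin m → EuclideanSpace ℝ (Fin n)) := Set.univ.pi fun s => ball (y s) r with hS
  set B : ℝ := A * (r ^ ε / (M * r / 2) ^ ((m * n : ℝ) + ε)) with hB
  have hSmeas : MeasurableSet S := MeasurableSet.univ_pi fun s => measurableSet_ball
  have hvol := volume_univ_pi_ball y hr
  have hSfin : volume S < ⊤ := by
    rw [hvol]
    exact ENNReal.pow_lt_top (ENNReal.mul_lt_top ENNReal.ofReal_lt_top measure_ball_lt_top)
  have hSreal : volume.real S = r ^ (m * n : ℝ) * V ^ m := by
    rw [Measure.real, hvol, ENNReal.toReal_pow, ENNReal.toReal_mul,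
      ENNReal.toReal_ofReal (by positivity), mul_pow, ← pow_mul, ← Nat.cast_mul,
      Real.rpow_natCast, mul_comm n m, hV, Measure.real]
  have hpoint : ∀ z ∈ S, |K (Function.update (Fin.cons (z l) z) l.succ x₀) -
      K (Function.update (Fin.cons (z l) z) l.succ x)| ≤ B := by
    intro z hz
    rcases eq_or_ne x x₀ with rfl | hne
    · rw [sub_self, abs_zero]
      positivity
    have hzl : ‖z l - y l‖ < r := by
      rw [← dist_eq_norm]
      exact hz l (Set.mem_univ l)
    have hxr : ‖x₀ - x‖ < r := by
      rw [← dist_eq_norm, dist_comm]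
      exact hx
    have hfar : M * r - r ≤ ‖x₀ - z l‖ := by
      have h1 := hy l
      have h2 := norm_sub_le_norm_sub_add_norm_sub x₀ (z l) (y l)
      linarith
    have hrM : 10 * r ≤ M * r := by gcongr
    set w : Fin (m + 1) → EuclideanSpace ℝ (Fin n) :=
      Function.update (Fin.cons (z l) z) l.succ x₀ with hw
    have hwl : w l.succ = x₀ := by simp [hw]
    have hw0 : w 0 = z l := by
      rw [hw, Function.update_of_ne (Fin.succ_ne_zero l).symm, Fin.cons_zero]
    have hwx : Function.update w l.succ x =
        Function.update (Fin.cons (z l) z) l.succ x := by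
      rw [hw, Function.update_idem]
    have hsup : ‖x₀ - z l‖ ≤
        Finset.univ.sup' Finset.univ_nonempty (fun k => ‖w l.succ - w k‖) := by
      have h := Finset.le_sup' (fun k => ‖w l.succ - w k‖) (Finset.mem_univ 0)
      simpa only [hwl, hw0] using h
    have hK' := hreg w x (by rw [hwl]; exact norm_pos_iff.2 (sub_ne_zero.2 hne.symm))
      (by rw [hwl] at hsup ⊢; linarith)
    rw [hwl, hwx] at hK'
    have hpair : M * r / 2 ≤ pairSum w := by
      have h := norm_sub_le_pairSum w (Fin.succ_pos l)
      rw [hwl, hw0, norm_sub_rev] at h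
      linarith
    refine hK'.trans ?_
    rw [hB, ← mul_div_assoc]
    gcongr
  have hmeas : Measurable fun z : Fin m → EuclideanSpace ℝ (Fin n) =>
      |K (Function.update (Fin.cons (z l) z) l.succ x₀) -
        K (Function.update (Fin.cons (z l) z) l.succ x)| := by
    have hupd : ∀ a : EuclideanSpace ℝ (Fin n),
        Measurable fun z : Fin m → EuclideanSpace ℝ (Fin n) =>
          (Function.update (Fin.cons (z l) z) l.succ a :
            Fin (m + 1) → EuclideanSpace ℝ (Fin n)) := by
      intro a
      refine (measurable_update_left (X := fun _ : Fin (m + 1) => EuclideanSpace ℝ (Fin n))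
        (a := l.succ) (x := a)).comp ?_
      refine measurable_pi_iff.2 fun k => ?_
      refine Fin.cases ?_ (fun j => ?_) k
      · simpa using measurable_pi_apply l
      · simpa using measurable_pi_apply j
    exact ((hK.comp (hupd x₀)).sub (hK.comp (hupd x))).abs
  have hnorm : ∀ z ∈ S, ‖|K (Function.update (Fin.cons (z l) z) l.succ x₀) -
      K (Function.update (Fin.cons (z l) z) l.succ x)|‖ ≤ B := by
    simpa only [Real.norm_eq_abs, abs_abs] using hpoint
  refine ⟨Measure.integrableOn_of_bounded hSfin.ne hmeas.aestronglyMeasurable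
    ((ae_restrict_iff' hSmeas).2 (.of_forall hnorm)), ?_⟩
  have h_integral := norm_setIntegral_le_of_norm_le_const hSfin hnorm
  refine (le_abs_self _).trans (h_integral.trans ?_)
  rw [hSreal, hB]
  calc A * (r ^ ε / (M * r / 2) ^ ((m * n : ℝ) + ε)) * (r ^ (m * n : ℝ) * V ^ m)
      = A * V ^ m * (r ^ ε / (M * r / 2) ^ ((m * n : ℝ) + ε) * r ^ (m * n : ℝ)) := by ring
    _ ≤ A * V ^ m * (2 ^ ((m * n : ℝ) + 1) / M ^ ((m * n : ℝ) + ε)) :=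
        mul_le_mul_of_nonneg_left (rpow_div_half_mul_rpow_le hr (by linarith) hε1)
          (by positivity)
    _ = _ := by ring
end

section
/- Let m, n ≥ 1 be integers, l ∈ {1,…,m}, ε ∈ (0,1], A > 0, and let K : (ℝ^n)^{m+1} → ℝ be a measurable kernel satisfying both the Calderón–Zygmund size condition with constant A and the Calderón–Zygmund regularity condition of order ε with constant A in the variable of position l. Then there exists C > 0 depending only on m and n such that for every r > 0, every M ≥ 10, every H^1-atom a associated with a ball B(x_0, r), all points y_s ∈ ℝ^n (s ∈ {1,…,m}, s ≠ l), and every x ∈ ℝ^n with |x − x_0| ≥ Mr and |x − y_s| ≥ Mr for all s ≠ l, one has |∫_{(ℝ^n)^m} K(x, z_1, …, z_m) a(z_l) ∏_{s≠l} χ_{B(y_s,r)}(z_s) dz_1⋯dz_m| ≤ C A M^{−(mn+ε)} r^{−n}. -/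
open MeasureTheory Metric

theorem norm_sub_zero_succ_le_pairSum {m n : ℕ} (y : Fin (m + 1) → EuclideanSpace ℝ (Fin n))
    (j : Fin m) : ‖y 0 - y j.succ‖ ≤ pairSum y := by
  have hnn : ∀ k k' : Fin (m + 1), 0 ≤ (if k < k' then ‖y k - y k'‖ else 0) := by
    intro k k'
    split_ifs <;> positivity
  unfold pairSum
  calc ‖y 0 - y j.succ‖ = (if (0 : Fin (m + 1)) < j.succ then ‖y 0 - y j.succ‖ else 0) := by
        rw [if_pos (Fin.succ_pos j)]
    _ ≤ ∑ k' : Fin (m + 1), (if 0 < k' then ‖y 0 - y k'‖ else 0) :=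
        Finset.single_le_sum (f := fun k' => if 0 < k' then ‖y 0 - y k'‖ else 0)
          (fun k' _ => hnn 0 k') (Finset.mem_univ j.succ)
    _ ≤ _ :=
        Finset.single_le_sum
          (f := fun k => ∑ k' : Fin (m + 1), if k < k' then ‖y k - y k'‖ else 0)
          (fun k _ => Finset.sum_nonneg fun k' _ => hnn k k') (Finset.mem_univ 0)

/-- A function whose dependence on the coordinate `l` is a mean-zero factor integrates to zero. -/
theorem integral_mul_update_eq_zero {m : ℕ} {E : Type*} [MeasureSpace E]
    [SigmaFinite (volume : Measure E)] (l : Fin m) (a : E → ℝ) (ha : ∫ z, a z = 0) (x₀ : E)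
    (g : (Fin m → E) → ℝ) :
    ∫ z : Fin m → E, a (z l) * g (Function.update z l x₀) = 0 := by
  obtain _ | m := m
  · exact l.elim0
  have h := (volume_preserving_piFinSuccAbove (fun _ : Fin (m + 1) => E) l).integral_comp'
    (g := fun p : E × (Fin m → E) => a p.1 * g (l.insertNth x₀ p.2))
  have h2 := integral_prod_mul (μ := (volume : Measure E))
    (ν := (volume : Measure (Fin m → E))) a (fun w => g (l.insertNth x₀ w))
  rw [ha, zero_mul] at h2
  rw [← Measure.volume_eq_prod] at h2
  rw [← h2, ← h]
  refine integral_congr_ae (Filter.Eventually.of_forall fun z => ?_)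
  simp [MeasurableEquiv.piFinSuccAbove, Fin.insertNthEquiv, Fin.insertNth_removeNth]

theorem integrable_of_ae_bound_of_support_subset {α : Type*} [MeasurableSpace α] {μ : Measure α}
    {f : α → ℝ} {S : Set α} {B : ℝ} (hf : AEStronglyMeasurable f μ) (hS : μ S ≠ ⊤)
    (hfS : Function.support f ⊆ S) (hB : ∀ᵐ z ∂μ, |f z| ≤ B) : Integrable f μ :=
  (integrableOn_iff_integrable_of_support_subset hfS).1 <|
    Measure.integrableOn_of_bounded (M := B) hS hf (ae_restrict_of_ae hB)

theorem abs_integral_le_of_ae_bound_of_support_subset {α : Type*} [MeasurableSpace α]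
    {μ : Measure α} {f : α → ℝ} {S : Set α} {B : ℝ} (hS : μ S ≠ ⊤)
    (hfS : Function.support f ⊆ S) (hB : ∀ᵐ z ∂μ, |f z| ≤ B) :
    |∫ z, f z ∂μ| ≤ B * μ.real S := by
  rw [← setIntegral_eq_integral_of_forall_compl_eq_zero (f := f) (s := S)
    (fun z hz => Function.notMem_support.1 fun h => hz (hfS h))]
  exact norm_setIntegral_le_of_norm_le_const_ae (f := f) (C := B) hS.lt_top (ae_restrict_of_ae hB)

theorem volume_real_pi_ball {m n : ℕ} (c : Fin m → EuclideanSpace ℝ (Fin n)) {r : ℝ}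
    (hr : 0 < r) :
    volume.real (Set.univ.pi fun s => ball (c s) r) =
      (r ^ n * volume.real (ball (0 : EuclideanSpace ℝ (Fin n)) 1)) ^ m := by
  have hb : ∀ x : EuclideanSpace ℝ (Fin n), volume.real (ball x r) =
      r ^ n * volume.real (ball (0 : EuclideanSpace ℝ (Fin n)) 1) := by
    intro x
    rw [measureReal_def, Measure.addHaar_ball_of_pos _ _ hr, ENNReal.toReal_mul,
      ENNReal.toReal_ofReal (by positivity), finrank_euclideanSpace_fin, measureReal_def]
  rw [measureReal_def, volume_pi_pi, ENNReal.toReal_prod]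
  simp only [← measureReal_def, hb, Finset.prod_const, Finset.card_univ, Fintype.card_fin]


/-- if `K` satisfies the Calderón–Zygmund size condition and the regularity
condition of order `ε ∈ (0,1]` (both with constant `A`) in the variable of position
`l ∈ {1, …, m}` (encoded as `l : Fin m`, position `l.succ`), `a` is an `H¹`-atom on
`B(x₀, r)`, and `|x − x₀| ≥ Mr`, `|x − y_s| ≥ Mr` for all `s ≠ l`, then
`|∫ K(x, z₁, …, z_m) a(z_l) ∏_{s≠l} χ_{B(y_s,r)}(z_s) dz| ≤ C A M^{−(mn+ε)} r^{−n}`. -/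
theorem kernel_atom_far_field_estimate (m n : ℕ) (hm : 1 ≤ m) (hn : 1 ≤ n) :
    ∃ C : ℝ, 0 < C ∧ ∀ (l : Fin m) (ε A : ℝ), 0 < ε → ε ≤ 1 → 0 < A →
      ∀ K : (Fin (m + 1) → EuclideanSpace ℝ (Fin n)) → ℝ, Measurable K →
      (∀ y : Fin (m + 1) → EuclideanSpace ℝ (Fin n),
        (∃ k k', y k ≠ y k') → |K y| ≤ A / pairSum y ^ (m * n)) →
      (∀ (y : Fin (m + 1) → EuclideanSpace ℝ (Fin n)) (y' : EuclideanSpace ℝ (Fin n)),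
        0 < ‖y l.succ - y'‖ →
        ‖y l.succ - y'‖ ≤
          (1 / 2) * Finset.univ.sup' Finset.univ_nonempty (fun k => ‖y l.succ - y k‖) →
        |K y - K (Function.update y l.succ y')| ≤
          A * ‖y l.succ - y'‖ ^ ε / pairSum y ^ ((m * n : ℝ) + ε)) →
      ∀ r M : ℝ, 0 < r → 10 ≤ M →
      ∀ (x₀ : EuclideanSpace ℝ (Fin n)) (a : EuclideanSpace ℝ (Fin n) → ℝ),
      Measurable a → (∀ z, z ∉ Metric.ball x₀ r → a z = 0) →
      (∀ᵐ z, |a z| ≤ (r ^ n)⁻¹) → (∫ z, a z) = 0 →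
      ∀ (y : Fin m → EuclideanSpace ℝ (Fin n)) (x : EuclideanSpace ℝ (Fin n)),
      M * r ≤ ‖x - x₀‖ → (∀ s, s ≠ l → M * r ≤ ‖x - y s‖) →
      Integrable (fun z : Fin m → EuclideanSpace ℝ (Fin n) =>
        K (Fin.cons x z) * a (z l) *
          ∏ s ∈ Finset.univ.erase l,
            (Metric.ball (y s) r).indicator (fun _ => (1 : ℝ)) (z s)) volume ∧
      |∫ z : Fin m → EuclideanSpace ℝ (Fin n),
          K (Fin.cons x z) * a (z l) *
            ∏ s ∈ Finset.univ.erase l,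
              (Metric.ball (y s) r).indicator (fun _ => (1 : ℝ)) (z s)| ≤
        C * A / M ^ ((m * n : ℝ) + ε) / r ^ n := by
  set v : ℝ := volume.real (ball (0 : EuclideanSpace ℝ (Fin n)) 1) with hv
  have hv0 : 0 < v := ENNReal.toReal_pos
    (measure_ball_pos _ _ one_pos).ne' measure_ball_lt_top.ne
  refine ⟨v ^ m * 2 ^ ((m * n : ℝ) + 1), by positivity, ?_⟩
  intro l ε A hε hε1 hA K hK hsize hreg r M hr hM x₀ a ha hasupp habd hamean y x hx hxy
  set P : (Fin m → EuclideanSpace ℝ (Fin n)) → ℝ := fun z =>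
    ∏ s ∈ Finset.univ.erase l, (ball (y s) r).indicator (fun _ => (1 : ℝ)) (z s) with hP
  set S : Set (Fin m → EuclideanSpace ℝ (Fin n)) :=
    Set.univ.pi fun s => ball (Function.update y l x₀ s) r with hS
  set D : ℝ := M * r / 2 with hD
  have hD0 : 0 < D := by positivity
  have hDM : D + r ≤ M * r := by rw [hD]; nlinarith
  have hrD : r ≤ 1 / 2 * D := by rw [hD]; nlinarith
  have hSfin : volume S ≠ ⊤ := by
    rw [hS, volume_pi_pi]
    exact (ENNReal.prod_lt_top fun s _ => measure_ball_lt_top).ne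
  have hP1 : ∀ z, |P z| ≤ 1 := by
    intro z
    rw [hP, Finset.abs_prod]
    refine Finset.prod_le_one (fun _ _ => abs_nonneg _) fun s _ => ?_
    by_cases h : z s ∈ ball (y s) r <;> simp [h]
  have hsupp : ∀ k : (Fin m → EuclideanSpace ℝ (Fin n)) → ℝ,
      Function.support (fun z => k z * a (z l) * P z) ⊆ S := by
    intro k z hz
    simp only [Function.mem_support, ne_eq, mul_eq_zero, not_or] at hz
    intro s _
    by_cases hs : s = l
    · subst hs
      beta_reduce
      rw [Function.update_self]
      by_contra h
      exact hz.1.2 (hasupp _ h)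
    · beta_reduce
      rw [Function.update_of_ne hs]
      by_contra h
      exact hz.2 (Finset.prod_eq_zero (Finset.mem_erase.2 ⟨hs, Finset.mem_univ s⟩)
        (Set.indicator_of_notMem h _))
  have hPmeas : Measurable P := by
    refine Finset.measurable_prod _ fun s _ => ?_
    exact (measurable_const.indicator measurableSet_ball).comp (measurable_pi_apply s)
  have hcons : Measurable fun z : Fin m → EuclideanSpace ℝ (Fin n) =>
      (Fin.cons x z : Fin (m + 1) → EuclideanSpace ℝ (Fin n)) := by
    refine measurable_pi_iff.2 fun k => ?_
    refine Fin.cases ?_ (fun j => ?_) k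
    · simp
    · simpa using measurable_pi_apply j
  have hupd : Measurable fun z : Fin m → EuclideanSpace ℝ (Fin n) =>
      Function.update z l x₀ := by
    refine measurable_pi_iff.2 fun k => ?_
    by_cases hk : k = l
    · subst hk; simp
    · simpa [Function.update_of_ne hk] using measurable_pi_apply k
  have hal : Measurable fun z : Fin m → EuclideanSpace ℝ (Fin n) => a (z l) :=
    ha.comp (measurable_pi_apply l)
  have habdl : ∀ᵐ z : Fin m → EuclideanSpace ℝ (Fin n), |a (z l)| ≤ (r ^ n)⁻¹ :=
    (Measure.quasiMeasurePreserving_eval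
      (fun _ : Fin m => (volume : Measure (EuclideanSpace ℝ (Fin n)))) l).ae habd
  have hfar : ∀ z : Fin m → EuclideanSpace ℝ (Fin n), z l ∈ ball x₀ r →
      D ≤ ‖x - z l‖ := by
    intro z hz
    rw [mem_ball_iff_norm] at hz
    have := norm_sub_le_norm_sub_add_norm_sub x (z l) x₀
    linarith
  have hpair : ∀ z : Fin m → EuclideanSpace ℝ (Fin n), z l ∈ ball x₀ r →
      D ≤ pairSum (Fin.cons x z : Fin (m + 1) → EuclideanSpace ℝ (Fin n)) := by
    intro z hz
    have := norm_sub_zero_succ_le_pairSum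
      (Fin.cons x z : Fin (m + 1) → EuclideanSpace ℝ (Fin n)) l
    rw [Fin.cons_zero, Fin.cons_succ] at this
    exact (hfar z hz).trans this
  have hKbd : ∀ z : Fin m → EuclideanSpace ℝ (Fin n), z l ∈ ball x₀ r →
      |K (Fin.cons x z)| ≤ A / D ^ (m * n) := by
    intro z hz
    refine (hsize (Fin.cons x z) ⟨0, l.succ, ?_⟩).trans ?_
    · rw [Fin.cons_zero, Fin.cons_succ, ← sub_ne_zero, ← norm_pos_iff]
      exact hD0.trans_le (hfar z hz)
    · have := hpair z hz
      gcongr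
  have hKdiff : ∀ z : Fin m → EuclideanSpace ℝ (Fin n), z l ∈ ball x₀ r →
      |K (Fin.cons x z) - K (Fin.cons x (Function.update z l x₀))| ≤
        A * r ^ ε / D ^ ((m * n : ℝ) + ε) := by
    intro z hz
    by_cases h0 : z l = x₀
    · rw [← h0, Function.update_eq_self, sub_self, abs_zero]
      positivity
    have hzr := hz
    rw [mem_ball_iff_norm] at hzr
    have h := hreg (Fin.cons x z) x₀ (by
      rw [Fin.cons_succ, norm_pos_iff, sub_ne_zero]; exact h0) (by
      rw [Fin.cons_succ]
      refine hzr.le.trans (hrD.trans ?_)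
      gcongr
      refine (hfar z hz).trans ?_
      rw [norm_sub_rev]
      exact Finset.le_sup' (fun k => ‖z l - (Fin.cons x z : Fin (m + 1) → _) k‖)
        (Finset.mem_univ 0))
    rw [Fin.cons_succ, ← Fin.cons_update] at h
    refine h.trans ?_
    have := hpair z hz
    gcongr
  have hbound : ∀ (k : (Fin m → EuclideanSpace ℝ (Fin n)) → ℝ) (B : ℝ), 0 ≤ B →
      (∀ z, z l ∈ ball x₀ r → |k z| ≤ B) →
      ∀ᵐ z, |k z * a (z l) * P z| ≤ B * (r ^ n)⁻¹ := by
    intro k B hB hk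
    filter_upwards [habdl] with z hz
    by_cases hzl : z l ∈ ball x₀ r
    · rw [abs_mul, abs_mul]
      calc |k z| * |a (z l)| * |P z| ≤ B * (r ^ n)⁻¹ * 1 := by
            gcongr
            · exact hk z hzl
            · exact hP1 z
        _ = _ := mul_one _
    · rw [hasupp _ hzl]
      simp only [mul_zero, zero_mul, abs_zero]
      positivity
  have hB0 : 0 ≤ A / D ^ (m * n) := by positivity
  have hF : Integrable fun z => K (Fin.cons x z) * a (z l) * P z :=
    integrable_of_ae_bound_of_support_subset
      (((hK.comp hcons).mul hal).mul hPmeas).aestronglyMeasurable hSfin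
      (hsupp fun z => K (Fin.cons x z)) (hbound _ _ hB0 hKbd)
  have hF' : Integrable fun z =>
      K (Fin.cons x (Function.update z l x₀)) * a (z l) * P z :=
    integrable_of_ae_bound_of_support_subset
      (((hK.comp (hcons.comp hupd)).mul hal).mul hPmeas).aestronglyMeasurable hSfin
      (hsupp fun z => K (Fin.cons x (Function.update z l x₀)))
      (hbound _ _ hB0 fun z _ => hKbd _ (by simpa using hr))
  have hPupd : ∀ z, P (Function.update z l x₀) = P z := by
    intro z
    refine Finset.prod_congr rfl fun s hs => ?_
    rw [Function.update_of_ne (Finset.ne_of_mem_erase hs)]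
  have hzero : ∫ z, K (Fin.cons x (Function.update z l x₀)) * a (z l) * P z = 0 := by
    rw [← integral_mul_update_eq_zero l a hamean x₀ (fun w => K (Fin.cons x w) * P w)]
    refine integral_congr_ae (Filter.Eventually.of_forall fun z => ?_)
    simp only [hPupd]
    ring
  refine ⟨hF, ?_⟩
  have hsub : ∫ z, K (Fin.cons x z) * a (z l) * P z =
      ∫ z, (K (Fin.cons x z) - K (Fin.cons x (Function.update z l x₀))) * a (z l) * P z := by
    simp only [sub_mul]
    rw [integral_sub hF hF', hzero, sub_zero]
  change |∫ z, K (Fin.cons x z) * a (z l) * P z| ≤ _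
  rw [hsub]
  refine (abs_integral_le_of_ae_bound_of_support_subset hSfin
    (hsupp fun z => K (Fin.cons x z) - K (Fin.cons x (Function.update z l x₀)))
    (hbound _ _ (by positivity) hKdiff)).trans ?_
  rw [hS, volume_real_pi_ball _ hr, ← hv]
  have hM0 : 0 < M := by linarith
  have hDp : D ^ ((m * n : ℝ) + ε) =
      M ^ ((m * n : ℝ) + ε) * ((r ^ n) ^ m * r ^ ε) / 2 ^ ((m * n : ℝ) + ε) := by
    rw [hD, Real.div_rpow (by positivity) (by norm_num), Real.mul_rpow hM0.le hr.le,
      Real.rpow_add hr, ← pow_mul, mul_comm n m, ← Real.rpow_natCast r (m * n)]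
    push_cast
    rfl
  have h2 : (2 : ℝ) ^ ((m * n : ℝ) + ε) ≤ 2 ^ ((m * n : ℝ) + 1) :=
    Real.rpow_le_rpow_of_exponent_le (by norm_num) (by linarith)
  calc A * r ^ ε / D ^ ((m * n : ℝ) + ε) * (r ^ n)⁻¹ * (r ^ n * v) ^ m
      = v ^ m * 2 ^ ((m * n : ℝ) + ε) * A / M ^ ((m * n : ℝ) + ε) / r ^ n := by
        rw [hDp, mul_pow]
        have := (Real.rpow_pos_of_pos hr ε).ne'
        have := (Real.rpow_pos_of_pos hM0 ((m * n : ℝ) + ε)).ne'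
        have := (Real.rpow_pos_of_pos two_pos ((m * n : ℝ) + ε)).ne'
        generalize r ^ ε = t at *
        generalize M ^ ((m * n : ℝ) + ε) = u at *
        generalize (2 : ℝ) ^ ((m * n : ℝ) + ε) = w at *
        field_simp
    _ ≤ _ := by gcongr
end

section
/- Let m, n ≥ 1 be integers, i ∈ {1,…,n}, j, l ∈ {1,…,m}. Let B̄_0, B̄_1, …, B̄_m be pairwise disjoint closed balls in ℝ^n, let g be a bounded measurable function supported in B̄_0, for s ∈ {1,…,m} let h_s be a bounded measurable function supported in B̄_s, and let b : ℝ^n → ℝ be locally integrable. Then all the integrals below converge absolutely and the following duality identity holds: ∫_{ℝ^n} b(x) Π_l(g, h_1, …, h_m)(x) dx = ∫_{ℝ^n} g(x) [ T^{(i)}_j(h_1,…,h_{l−1}, b·h_l, h_{l+1},…,h_m)(x) − b(x)·T^{(i)}_j(h_1,…,h_m)(x) ] dx. -/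
open MeasureTheory Metric

/-- `T_j^{(i)}(f₁, …, f_m)(x) = ∫ K_j^{(i)}(x, z₁, …, z_m) ∏_s f_s(z_s) dz`. -/
noncomputable def Tmul (m n : ℕ) (j : Fin m) (i : Fin n)
    (h : Fin m → EuclideanSpace ℝ (Fin n) → ℝ) (x : EuclideanSpace ℝ (Fin n)) : ℝ :=
  ∫ z : Fin m → EuclideanSpace ℝ (Fin n),
    rieszKernelComp m n j i (Fin.cons x z) * ∏ s, h s (z s)

/-- The `l`-th partial adjoint
`T_{j,l}^{*,(i)}(h₁, …, h_{l−1}, g, h_{l+1}, …, h_m)(x)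
  = ∫ K_j^{(i)}(z_l, z₁, …, z_{l−1}, x, z_{l+1}, …, z_m) g(z_l) ∏_{s≠l} h_s(z_s) dz`. -/
noncomputable def TmulAdj (m n : ℕ) (j l : Fin m) (i : Fin n)
    (g : EuclideanSpace ℝ (Fin n) → ℝ) (h : Fin m → EuclideanSpace ℝ (Fin n) → ℝ)
    (x : EuclideanSpace ℝ (Fin n)) : ℝ :=
  ∫ z : Fin m → EuclideanSpace ℝ (Fin n),
    rieszKernelComp m n j i (Function.update (Fin.cons (z l) z) l.succ x) *
      (g (z l) * ∏ s ∈ Finset.univ.erase l, h s (z s))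

/-- `Π_l(g, h₁, …, h_m) = h_l · T_{j,l}^{*,(i)}(…, g, …) − g · T_j^{(i)}(h₁, …, h_m)`. -/
noncomputable def PiOp (m n : ℕ) (j l : Fin m) (i : Fin n)
    (g : EuclideanSpace ℝ (Fin n) → ℝ) (h : Fin m → EuclideanSpace ℝ (Fin n) → ℝ)
    (x : EuclideanSpace ℝ (Fin n)) : ℝ :=
  h l x * TmulAdj m n j l i g h x - g x * Tmul m n j i h x

open Function in
/-- Exchanging the first variable with the `l`-th of the remaining ones preserves volume. -/
lemma measurePreserving_exchange {E : Type*} [MeasureSpace E]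
    [SigmaFinite (volume : Measure E)] {m : ℕ} (l : Fin m) :
    MeasurePreserving (fun p : E × (Fin m → E) => (p.2 l, update p.2 l p.1))
      (volume.prod volume) (volume.prod volume) := by
  have he := volume_preserving_piFinSuccAbove (fun _ : Fin (m + 1) => E) 0
  have hs := volume_measurePreserving_piCongrLeft (fun _ : Fin (m + 1) => E)
    (Equiv.swap 0 l.succ)
  have key := he.comp (hs.comp (he.symm _))
  rw [← Measure.volume_eq_prod]
  convert key using 1
  funext p
  have hsw : ∀ (f : Fin (m + 1) → E) (k : Fin (m + 1)),
      MeasurableEquiv.piCongrLeft (fun _ : Fin (m + 1) => E) (Equiv.swap 0 l.succ) f k =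
        f (Equiv.swap 0 l.succ k) := fun f k => by
    conv_lhs => rw [← Equiv.swap_apply_self 0 l.succ k]
    exact Equiv.piCongrLeft_apply_apply (fun _ : Fin (m + 1) => E) _ f _
  ext s
  · simp [MeasurableEquiv.piFinSuccAbove, Fin.insertNthEquiv, hsw]
  · rcases eq_or_ne s l with rfl | hsl
    · simp [MeasurableEquiv.piFinSuccAbove, Fin.insertNthEquiv, hsw, Fin.tail]
    · have : Equiv.swap 0 l.succ s.succ = s.succ :=
        Equiv.swap_apply_of_ne_of_ne (Fin.succ_ne_zero s) (by simpa using hsl)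
      simp [MeasurableEquiv.piFinSuccAbove, Fin.insertNthEquiv, hsw, Fin.tail, this, hsl]

lemma measurable_rieszKernelComp (m n : ℕ) (j : Fin m) (i : Fin n) :
    Measurable (rieszKernelComp m n j i) := by
  unfold rieszKernelComp
  fun_prop

lemma continuousAt_rieszKernelComp {m n : ℕ} (j : Fin m) (i : Fin n)
    {y : Fin (m + 1) → EuclideanSpace ℝ (Fin n)} (hy : y 0 ≠ y j.succ) :
    ContinuousAt (rieszKernelComp m n j i) y := by
  unfold rieszKernelComp
  refine ContinuousAt.div (by fun_prop) (by fun_prop) (pow_ne_zero _ ?_)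
  refine (Real.sqrt_pos.2 (Finset.sum_pos' (fun s _ => by positivity)
    ⟨j, Finset.mem_univ j, ?_⟩)).ne'
  have := norm_pos_iff.2 (sub_ne_zero.2 hy)
  positivity

/-- The kernel tensored with integrable functions whose supports lie in disjoint balls is
integrable in all variables. -/
lemma integrable_rieszKernelComp_mul {m n : ℕ} (j : Fin m) (i : Fin n)
    {c : Fin (m + 1) → EuclideanSpace ℝ (Fin n)} {ρ : Fin (m + 1) → ℝ}
    (hdisj : Disjoint (closedBall (c 0) (ρ 0)) (closedBall (c j.succ) (ρ j.succ)))
    {v : EuclideanSpace ℝ (Fin n) → ℝ} (hv : Integrable v)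
    (hvs : ∀ x, x ∉ closedBall (c 0) (ρ 0) → v x = 0)
    {u : Fin m → EuclideanSpace ℝ (Fin n) → ℝ} (hu : ∀ s, Integrable (u s))
    (hus : ∀ s, ∀ x, x ∉ closedBall (c s.succ) (ρ s.succ) → u s x = 0) :
    Integrable (fun p : EuclideanSpace ℝ (Fin n) × (Fin m → EuclideanSpace ℝ (Fin n)) =>
      rieszKernelComp m n j i (Fin.cons p.1 p.2) * (v p.1 * ∏ s, u s (p.2 s)))
      (volume.prod volume) := by
  let S : Set (EuclideanSpace ℝ (Fin n) × (Fin m → EuclideanSpace ℝ (Fin n))) :=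
    closedBall (c 0) (ρ 0) ×ˢ Set.univ.pi fun s => closedBall (c s.succ) (ρ s.succ)
  let κ : EuclideanSpace ℝ (Fin n) × (Fin m → EuclideanSpace ℝ (Fin n)) → ℝ :=
    fun p => rieszKernelComp m n j i (Fin.cons p.1 p.2)
  have hcons : Continuous fun p : EuclideanSpace ℝ (Fin n) × (Fin m → EuclideanSpace ℝ (Fin n)) =>
      (Fin.cons p.1 p.2 : Fin (m + 1) → EuclideanSpace ℝ (Fin n)) :=
    continuous_pi fun k => by
      refine Fin.cases ?_ (fun s => ?_) k <;> simp only [Fin.cons_zero, Fin.cons_succ] <;> fun_prop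
  have hS : IsCompact S :=
    (isCompact_closedBall _ _).prod (isCompact_univ_pi fun s => isCompact_closedBall _ _)
  have hκ : Measurable κ := (measurable_rieszKernelComp m n j i).comp hcons.measurable
  have hκS : ContinuousOn κ S := fun p hp => by
    refine (ContinuousAt.comp (f := fun p : EuclideanSpace ℝ (Fin n) ×
      (Fin m → EuclideanSpace ℝ (Fin n)) =>
        (Fin.cons p.1 p.2 : Fin (m + 1) → EuclideanSpace ℝ (Fin n)))
      (continuousAt_rieszKernelComp j i ?_) hcons.continuousAt).continuousWithinAt
    simpa using hdisj.ne_of_mem hp.1 (hp.2 j (Set.mem_univ j))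
  obtain ⟨C, hC⟩ := hS.exists_bound_of_continuousOn hκS
  have hprod : Integrable (fun p : EuclideanSpace ℝ (Fin n) × (Fin m → EuclideanSpace ℝ (Fin n)) =>
      v p.1 * ∏ s, u s (p.2 s)) (volume.prod volume) :=
    hv.mul_prod (Integrable.fintype_prod hu)
  have hbdd : ∀ p, ‖S.indicator κ p‖ ≤ max C 0 := fun p => by
    by_cases hp : p ∈ S
    · simpa [hp] using Or.inl (hC p hp)
    · simp [hp]
  refine (hprod.bdd_mul (hκ.indicator hS.measurableSet).aestronglyMeasurable
    (Filter.Eventually.of_forall hbdd)).congr (Filter.Eventually.of_forall fun p => ?_)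
  by_cases hp : p ∈ S
  · simp [hp, κ]
  · have hzero : v p.1 * ∏ s, u s (p.2 s) = 0 := by
      by_contra hne
      refine hp ⟨not_imp_comm.1 (hvs p.1) (left_ne_zero_of_mul hne), fun s _ => ?_⟩
      exact not_imp_comm.1 (hus s _)
        (Finset.prod_ne_zero_iff.1 (right_ne_zero_of_mul hne) s (Finset.mem_univ s))
    simp [hzero]

lemma mul_Tmul {m n : ℕ} (j : Fin m) (i : Fin n) (v : EuclideanSpace ℝ (Fin n) → ℝ)
    (u : Fin m → EuclideanSpace ℝ (Fin n) → ℝ) (x : EuclideanSpace ℝ (Fin n)) :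
    v x * Tmul m n j i u x =
      ∫ z : Fin m → EuclideanSpace ℝ (Fin n),
        rieszKernelComp m n j i (Fin.cons x z) * (v x * ∏ s, u s (z s)) := by
  rw [Tmul, ← integral_const_mul]
  exact integral_congr_ae (Filter.Eventually.of_forall fun z => mul_left_comm _ _ _)

open Function in
lemma mul_TmulAdj {m n : ℕ} (j l : Fin m) (i : Fin n) (g : EuclideanSpace ℝ (Fin n) → ℝ)
    (u : Fin m → EuclideanSpace ℝ (Fin n) → ℝ) (x : EuclideanSpace ℝ (Fin n)) :
    u l x * TmulAdj m n j l i g u x =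
      ∫ z : Fin m → EuclideanSpace ℝ (Fin n),
        rieszKernelComp m n j i (Fin.cons (z l) (update z l x)) *
          (g (z l) * ∏ s, u s (update z l x s)) := by
  rw [TmulAdj, ← integral_const_mul]
  refine integral_congr_ae (Filter.Eventually.of_forall fun z => ?_)
  have hprod : ∏ s, u s (update z l x s) =
      u l x * ∏ s ∈ Finset.univ.erase l, u s (z s) := by
    rw [← Finset.mul_prod_erase _ _ (Finset.mem_univ l), update_self]
    congr 1
    exact Finset.prod_congr rfl fun s hs => by rw [update_of_ne (Finset.ne_of_mem_erase hs)]
  simp only [hprod, Fin.cons_update]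
  ring

open Function in
/-- The `l`-th partial adjoint does not depend on the `l`-th function of the family. -/
lemma TmulAdj_update {m n : ℕ} (j l : Fin m) (i : Fin n) (g : EuclideanSpace ℝ (Fin n) → ℝ)
    (h : Fin m → EuclideanSpace ℝ (Fin n) → ℝ) (f x) :
    TmulAdj m n j l i g (update h l f) x = TmulAdj m n j l i g h x := by
  have hprod (z : Fin m → EuclideanSpace ℝ (Fin n)) :
      ∏ s ∈ Finset.univ.erase l, update h l f s (z s) =
        ∏ s ∈ Finset.univ.erase l, h s (z s) :=
    Finset.prod_congr rfl fun s hs => by rw [update_of_ne (Finset.ne_of_mem_erase hs)]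
  simp only [TmulAdj, hprod]

/-- A locally integrable function times a bounded measurable function supported in a ball is
integrable. -/
lemma integrable_mul_of_support_closedBall {E : Type*} [PseudoMetricSpace E] [ProperSpace E]
    [MeasurableSpace E] [OpensMeasurableSpace E] {μ : Measure E} {b f : E → ℝ}
    (hb : LocallyIntegrable b μ) (hf : Measurable f) (hfb : ∃ A : ℝ, ∀ x, |f x| ≤ A)
    {c : E} {r : ℝ} (hfs : ∀ x, x ∉ closedBall c r → f x = 0) :
    Integrable (fun x => b x * f x) μ := by
  obtain ⟨A, hA⟩ := hfb
  have hint : Integrable ((closedBall c r).indicator b) μ :=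
    (hb.integrableOn_isCompact (isCompact_closedBall c r)).integrable_indicator
      measurableSet_closedBall
  refine (hint.mul_bdd hf.aestronglyMeasurable
    (Filter.Eventually.of_forall hA)).congr (Filter.Eventually.of_forall fun x => ?_)
  by_cases hx : x ∈ closedBall c r
  · simp [hx]
  · simp [hfs x hx]

/-- duality identity
`∫ b Π_l(g, h₁, …, h_m) = ∫ g (T_j^{(i)}(h₁, …, b·h_l, …, h_m) − b · T_j^{(i)}(h₁, …, h_m))`
for bounded measurable `g, h₁, …, h_m` supported in pairwise disjoint closed balls and
locally integrable `b`, together with absolute convergence of both sides. -/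
theorem piOp_duality_identity (m n : ℕ) (hm : 1 ≤ m) (hn : 1 ≤ n)
    (i : Fin n) (j l : Fin m)
    (c : Fin (m + 1) → EuclideanSpace ℝ (Fin n)) (ρ : Fin (m + 1) → ℝ)
    (hdisj : ∀ k k', k ≠ k' →
      Disjoint (Metric.closedBall (c k) (ρ k)) (Metric.closedBall (c k') (ρ k')))
    (g : EuclideanSpace ℝ (Fin n) → ℝ) (hgm : Measurable g)
    (hgb : ∃ A : ℝ, ∀ x, |g x| ≤ A)
    (hgs : ∀ x, x ∉ Metric.closedBall (c 0) (ρ 0) → g x = 0)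
    (h : Fin m → EuclideanSpace ℝ (Fin n) → ℝ) (hhm : ∀ s, Measurable (h s))
    (hhb : ∀ s, ∃ A : ℝ, ∀ x, |h s x| ≤ A)
    (hhs : ∀ s, ∀ x, x ∉ Metric.closedBall (c s.succ) (ρ s.succ) → h s x = 0)
    (b : EuclideanSpace ℝ (Fin n) → ℝ) (hb : LocallyIntegrable b volume) :
    Integrable (fun x => b x * PiOp m n j l i g h x) volume ∧
    Integrable (fun x => g x *
      (Tmul m n j i (Function.update h l (fun y => b y * h l y)) x -
        b x * Tmul m n j i h x)) volume ∧
    (∫ x, b x * PiOp m n j l i g h x) =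
      ∫ x, g x * (Tmul m n j i (Function.update h l (fun y => b y * h l y)) x -
        b x * Tmul m n j i h x) := by
  set u := Function.update h l (fun y => b y * h l y) with hu_def
  have hone : LocallyIntegrable (fun _ : EuclideanSpace ℝ (Fin n) => (1 : ℝ)) volume :=
    locallyIntegrable_const 1
  have hg : Integrable g := by
    simpa using integrable_mul_of_support_closedBall hone hgm hgb hgs
  have hbg : Integrable fun x => b x * g x := integrable_mul_of_support_closedBall hb hgm hgb hgs
  have hh (s) : Integrable (h s) := by
    simpa using integrable_mul_of_support_closedBall hone (hhm s) (hhb s) (hhs s)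
  have hu (s) : Integrable (u s) := by
    rcases eq_or_ne s l with rfl | hsl
    · simpa [u] using integrable_mul_of_support_closedBall hb (hhm s) (hhb s) (hhs s)
    · simpa [u, hsl] using hh s
  have hus (s) (x) (hx : x ∉ closedBall (c s.succ) (ρ s.succ)) : u s x = 0 := by
    rcases eq_or_ne s l with rfl | hsl
    · simp [u, hhs s x hx]
    · simp [u, hsl, hhs s x hx]
  have hd := hdisj 0 j.succ (Fin.succ_ne_zero j).symm
  have hG := integrable_rieszKernelComp_mul j i hd hg hgs hu hus
  have hB := integrable_rieszKernelComp_mul j i hd hbg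
    (fun x hx => by simp [hgs x hx]) hh hhs
  have hσ := measurePreserving_exchange (E := EuclideanSpace ℝ (Fin n)) l
  have hGσ := hσ.integrable_comp_of_integrable hG
  have hIB : Integrable fun x => (b x * g x) * Tmul m n j i h x := by
    simpa only [mul_Tmul j i (fun x => b x * g x) h] using hB.integral_prod_left
  have hIG : Integrable fun x => g x * Tmul m n j i u x := by
    simpa only [mul_Tmul] using hG.integral_prod_left
  have hIA : Integrable fun x => u l x * TmulAdj m n j l i g u x := by
    simpa only [mul_TmulAdj, Function.comp_apply] using hGσ.integral_prod_left
  have hswap : ∫ x, u l x * TmulAdj m n j l i g u x = ∫ x, g x * Tmul m n j i u x := by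
    simp only [mul_TmulAdj, mul_Tmul]
    rw [← integral_prod _ hG, ← hσ.map_eq, integral_map hσ.aemeasurable
      (by rw [hσ.map_eq]; exact hG.aestronglyMeasurable)]
    exact (integral_prod _ hGσ).symm
  have hL : (fun x => b x * PiOp m n j l i g h x) = fun x =>
      u l x * TmulAdj m n j l i g u x - (b x * g x) * Tmul m n j i h x := by
    funext x
    rw [hu_def, TmulAdj_update, Function.update_self, PiOp]
    ring
  have hR : (fun x => g x * (Tmul m n j i u x - b x * Tmul m n j i h x)) = fun x =>
      g x * Tmul m n j i u x - (b x * g x) * Tmul m n j i h x := by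
    funext x
    ring
  rw [hL, hR]
  exact ⟨hIA.sub hIB, hIG.sub hIB, by rw [integral_sub hIA hIB, integral_sub hIG hIB, hswap]⟩
end
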